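/- Let n ≥ 2, let Λ₁ = ℤ[i](ie_1 − e_2) + Σ_{j=2}^{n} ℤ[i](e_{j-1} − e_j) ⊆ ℂⁿ and Λ₂ = Λ₁ + ℤ[i]e_n (both G(4,2,n)-invariant ℤ-lattices of full rank 2n). Then for Λ = Λ₁ and for Λ = Λ₂, the affine reflection group W = G(4,2,n) ⋉ Λ has the Steinberg property: every point of ℂⁿ fixed by some non-identity element of W lies on a reflecting hyperplane of W. -/

import Mathlib

open Matrix Complex

noncomputable section

/-- `ℤ[ζ] = ℤ + ℤζ` as a subset of `ℂ`. -/
def Zlat (ζ : ℂ) : Set ℂ := {z | ∃ a b : ℤ, z = (a : ℂ) + (b : ℂ) * ζ}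

/-- Membership in the complex reflection group `G(r,p,n)`: monomial matrices whose
nonzero entries are `r`-th roots of unity and whose product of nonzero entries,
raised to the power `r / p`, equals `1`. -/
def IsGrpn (r p n : ℕ) (M : Matrix (Fin n) (Fin n) ℂ) : Prop :=
  (∀ i, ∃! j, M i j ≠ 0) ∧ (∀ j, ∃! i, M i j ≠ 0) ∧
  (∀ i j, M i j ≠ 0 → M i j ^ r = 1) ∧
  (∏ i, ∑ j, M i j) ^ (r / p) = 1

/-- The affine transformation `v ↦ M v + t` encoded by the pair `g = (M, t)`. -/
def applyAff {n : ℕ} (g : Matrix (Fin n) (Fin n) ℂ × (Fin n → ℂ)) (v : Fin n → ℂ) :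
    Fin n → ℂ :=
  g.1.mulVec v + g.2

/-- An affine hyperplane in `ℂⁿ`: the solution set of a nonzero affine-linear equation. -/
def IsAffineHyperplane {n : ℕ} (H : Set (Fin n → ℂ)) : Prop :=
  ∃ a : Fin n → ℂ, a ≠ 0 ∧ ∃ c : ℂ, H = {v | ∑ i, a i * v i = c}

/-- A reflecting hyperplane of `W`: an affine hyperplane fixed pointwise by some
non-identity element of `W`. -/
def IsReflectingHyperplane {n : ℕ}
    (W : Matrix (Fin n) (Fin n) ℂ × (Fin n → ℂ) → Prop) (H : Set (Fin n → ℂ)) : Prop :=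
  IsAffineHyperplane H ∧
  ∃ g, W g ∧ (∃ v, applyAff g v ≠ v) ∧ ∀ v ∈ H, applyAff g v = v

/-- `W` has the Steinberg property: every point fixed by some non-identity element
of `W` lies on a reflecting hyperplane of `W`. -/
def SteinbergProperty {n : ℕ}
    (W : Matrix (Fin n) (Fin n) ℂ × (Fin n → ℂ) → Prop) : Prop :=
  ∀ u : Fin n → ℂ,
    (∃ g, W g ∧ (∃ v, applyAff g v ≠ v) ∧ applyAff g u = u) →
    ∃ H, IsReflectingHyperplane W H ∧ u ∈ H

/-- `stdGen n 0 = e₁` and, for `j ≥ 1` (0-indexed), `stdGen n j = e_{j-1} - e_j`. -/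
def stdGen (n : ℕ) (j : Fin n) : Fin n → ℂ := fun i =>
  if i = j then (if (j : ℕ) = 0 then 1 else -1)
  else if (i : ℕ) + 1 = (j : ℕ) then 1 else 0

/-- `genB n ξ 0 = ξ e₁ - e₂` and, for `j ≥ 1` (0-indexed), `genB n ξ j = e_{j-1} - e_j`. -/
def genB (n : ℕ) (ξ : ℂ) (j : Fin n) : Fin n → ℂ :=
  if (j : ℕ) = 0 then
    (fun i => if (i : ℕ) = 0 then ξ else if (i : ℕ) = 1 then -1 else 0)
  else stdGen n j

/-- The Gaussian integers as a subring of `ℂ`. -/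
def gaussianSubring : Subring ℂ where
  carrier := Zlat I
  zero_mem' := ⟨0, 0, by simp⟩
  one_mem' := ⟨1, 0, by simp⟩
  add_mem' := by
    rintro _ _ ⟨a, b, rfl⟩ ⟨c, d, rfl⟩
    exact ⟨a + c, b + d, by push_cast; ring⟩
  neg_mem' := by
    rintro _ ⟨a, b, rfl⟩
    exact ⟨-a, -b, by push_cast; ring⟩
  mul_mem' := by
    rintro _ _ ⟨a, b, rfl⟩ ⟨c, d, rfl⟩
    refine ⟨a * c - b * d, a * d + b * c, ?_⟩
    push_cast
    linear_combination (b * d : ℂ) * I_mul_I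

/-- The ideal of Gaussian integers generated by `1 + i`, as an additive subgroup of `ℂ`. -/
def evenGaussian : AddSubgroup ℂ where
  carrier := {z | ∃ a b : ℤ, Even (a + b) ∧ z = a + b * I}
  zero_mem' := ⟨0, 0, by simp⟩
  add_mem' := by
    rintro _ _ ⟨a, b, h, rfl⟩ ⟨c, d, h', rfl⟩
    exact ⟨a + c, b + d, by rw [add_add_add_comm]; exact h.add h', by push_cast; ring⟩
  neg_mem' := by
    rintro _ ⟨a, b, h, rfl⟩
    exact ⟨-a, -b, by rw [← neg_add]; exact h.neg, by push_cast; ring⟩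

lemma I_mem_gaussianSubring : I ∈ gaussianSubring := ⟨0, 1, by simp⟩

lemma mul_mem_evenGaussian {x y : ℂ} (hx : x ∈ gaussianSubring) (hy : y ∈ evenGaussian) :
    x * y ∈ evenGaussian := by
  obtain ⟨a, b, rfl⟩ := hx
  obtain ⟨c, d, h, rfl⟩ := hy
  refine ⟨a * c - b * d, a * d + b * c, ?_, ?_⟩
  · obtain ⟨k, hk⟩ := h
    exact ⟨(a + b) * k - b * d, by linear_combination (a + b) * hk⟩
  · push_cast
    linear_combination (b * d : ℂ) * I_mul_I

lemma one_sub_I_mem_evenGaussian : 1 - I ∈ evenGaussian :=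
  ⟨1, -1, by simp, by push_cast; ring⟩

lemma one_add_I_mem_evenGaussian : 1 + I ∈ evenGaussian :=
  ⟨1, 1, by simp, by push_cast; ring⟩

lemma exists_eq_one_sub_I_mul {z : ℂ} (hz : z ∈ evenGaussian) :
    ∃ w ∈ gaussianSubring, z = (1 - I) * w := by
  obtain ⟨a, b, ⟨k, hk⟩, rfl⟩ := hz
  obtain rfl : a = k + k - b := by omega
  refine ⟨(k - b : ℤ) + k * I, ⟨_, _, rfl⟩, ?_⟩
  push_cast
  linear_combination (k : ℂ) * I_mul_I

/-- Two Gaussian integers not divisible by `1 + i` agree modulo `2` up to a unit. -/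
lemma exists_unit_sub_eq_two_mul {x y : ℂ} (hx : x ∈ gaussianSubring) (hy : y ∈ gaussianSubring)
    (hx' : x ∉ evenGaussian) (hy' : y ∉ evenGaussian) :
    ∃ ζ : ℂ, ζ ^ 4 = 1 ∧ ∃ w ∈ gaussianSubring, x - ζ * y = 2 * w := by
  obtain ⟨a, b, rfl⟩ := hx
  obtain ⟨c, d, rfl⟩ := hy
  have h₁ : ¬ Even (a + b) := fun h => hx' ⟨a, b, h, rfl⟩
  have h₂ : ¬ Even (c + d) := fun h => hy' ⟨c, d, h, rfl⟩
  rw [Int.not_even_iff_odd] at h₁ h₂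
  obtain ⟨k, hk⟩ := h₁
  obtain ⟨l, hl⟩ := h₂
  obtain rfl : b = 2 * k + 1 - a := by omega
  obtain rfl : d = 2 * l + 1 - c := by omega
  rcases Int.even_or_odd' (a - c) with ⟨e, he | he⟩
  · obtain rfl : a = 2 * e + c := by omega
    refine ⟨1, one_pow 4, (e : ℤ) + (k - l - e : ℤ) * I, ⟨_, _, rfl⟩, ?_⟩
    push_cast
    ring
  · obtain rfl : a = 2 * e + 1 + c := by omega
    refine ⟨I, I_pow_four, (e + l + 1 : ℤ) + (k - e - c : ℤ) * I, ⟨_, _, rfl⟩, ?_⟩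
    push_cast
    linear_combination (-(2 * l + 1 - c) : ℂ) * I_mul_I

lemma eq_of_pow_four_eq_one {ζ : ℂ} (h : ζ ^ 4 = 1) : ζ = 1 ∨ ζ = -1 ∨ ζ = I ∨ ζ = -I := by
  have h' : (ζ - 1) * ((ζ + 1) * ((ζ - I) * (ζ + I))) = 0 := by
    linear_combination h - (ζ ^ 2 - 1) * I_mul_I
  simpa only [mul_eq_zero, sub_eq_zero, add_eq_zero_iff_eq_neg] using h'

lemma mem_gaussianSubring_of_pow_four {ζ : ℂ} (h : ζ ^ 4 = 1) : ζ ∈ gaussianSubring := by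
  rcases eq_of_pow_four_eq_one h with rfl | rfl | rfl | rfl
  · exact one_mem _
  · exact neg_mem (one_mem _)
  · exact I_mem_gaussianSubring
  · exact neg_mem I_mem_gaussianSubring

lemma one_sub_mem_evenGaussian {ζ : ℂ} (h : ζ ^ 4 = 1) : 1 - ζ ∈ evenGaussian := by
  rcases eq_of_pow_four_eq_one h with rfl | rfl | rfl | rfl
  · simp [zero_mem]
  · exact ⟨2, 0, by simp, by norm_num⟩
  · exact one_sub_I_mem_evenGaussian
  · simpa using one_add_I_mem_evenGaussian

section Monomial

variable {n : ℕ}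

/-- The monomial matrix with entries `m i` in the positions `(i, σ i)`. -/
def monomialMatrix (σ : Equiv.Perm (Fin n)) (m : Fin n → ℂ) : Matrix (Fin n) (Fin n) ℂ :=
  fun i j => if j = σ i then m i else 0

lemma monomialMatrix_mulVec (σ : Equiv.Perm (Fin n)) (m v : Fin n → ℂ) (i : Fin n) :
    (monomialMatrix σ m *ᵥ v) i = m i * v (σ i) := by
  simp [monomialMatrix, Matrix.mulVec, dotProduct]

lemma isGrpn_monomialMatrix {r p : ℕ} (hr : r ≠ 0) (σ : Equiv.Perm (Fin n)) {m : Fin n → ℂ}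
    (hm : ∀ i, m i ^ r = 1) (hprod : (∏ i, m i) ^ (r / p) = 1) :
    IsGrpn r p n (monomialMatrix σ m) := by
  have hm0 : ∀ i, m i ≠ 0 := fun i h => by simpa [h, hr] using hm i
  have hne : ∀ i j, monomialMatrix σ m i j ≠ 0 ↔ j = σ i := by
    intro i j
    simp [monomialMatrix, hm0 i]
  refine ⟨fun i => ?_, fun j => ?_, fun i j h => ?_, ?_⟩
  · simp only [hne]
    exact ⟨σ i, rfl, fun _ h => h⟩
  · simp only [hne]
    exact ⟨σ.symm j, by simp, fun i h => by simp [h]⟩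
  · rw [hne] at h
    simpa [monomialMatrix, h] using hm i
  · simpa [monomialMatrix] using hprod

variable {Λ : Set (Fin n → ℂ)}

lemma isReflectingHyperplane_swap {j l : Fin n} (hjl : j ≠ l) {ζ c : ℂ} (hζ : ζ ^ 4 = 1)
    (ht : Pi.single j c - Pi.single l (ζ⁻¹ * c) ∈ Λ) :
    IsReflectingHyperplane (fun g => IsGrpn 4 2 n g.1 ∧ g.2 ∈ Λ) {v | v j - ζ * v l = c} := by
  have hζ0 : ζ ≠ 0 := fun h => by simp [h] at hζ
  refine ⟨⟨Pi.single j 1 - Pi.single l ζ, fun h => ?_, c, ?_⟩,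
    (monomialMatrix (Equiv.swap j l) (Pi.mulSingle j ζ * Pi.mulSingle l ζ⁻¹),
      Pi.single j c - Pi.single l (ζ⁻¹ * c)), ⟨isGrpn_monomialMatrix four_ne_zero _ ?_ ?_, ht⟩,
    ⟨Pi.single j (c + 1), fun h => ?_⟩, fun v hv => ?_⟩
  · simpa [hjl] using congrFun h j
  · ext v
    simp [sub_mul, Finset.sum_sub_distrib, Pi.single_apply]
  · intro i
    by_cases hij : i = j
    · subst hij
      simp [hjl, hζ]
    · by_cases hil : i = l
      · subst hil
        simp [hij, hζ]
      · simp [hij, hil]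
  · simp [Finset.prod_mul_distrib, hζ0]
  · have := congrFun h j
    simp [applyAff, monomialMatrix, hjl] at this
  · have hv : v j - ζ * v l = c := hv
    ext i
    by_cases hij : i = j
    · subst hij
      simp [applyAff, monomialMatrix_mulVec, hjl, ← hv]
    · by_cases hil : i = l
      · subst hil
        simp [applyAff, monomialMatrix_mulVec, hij, ← hv]
        field_simp
        ring
      · simp [applyAff, monomialMatrix_mulVec, hij, hil, Equiv.swap_apply_of_ne_of_ne]

lemma isReflectingHyperplane_neg {j : Fin n} {c : ℂ} (ht : Pi.single j c ∈ Λ) :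
    IsReflectingHyperplane (fun g => IsGrpn 4 2 n g.1 ∧ g.2 ∈ Λ) {v | 2 * v j = c} := by
  refine ⟨⟨Pi.single j 2, fun h => ?_, c, ?_⟩,
    (monomialMatrix 1 (Pi.mulSingle j (-1)), Pi.single j c),
    ⟨isGrpn_monomialMatrix four_ne_zero _ ?_ ?_, ht⟩,
    ⟨Pi.single j ((c + 1) / 2), fun h => ?_⟩, fun v hv => ?_⟩
  · simpa using congrFun h j
  · ext v
    simp [Pi.single_apply]
  · intro i
    by_cases hij : i = j
    · subst hij
      simp
      norm_num
    · simp [hij]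
  · simp
  · have := congrFun h j
    simp [applyAff, monomialMatrix] at this
    exact one_ne_zero (α := ℂ) (by linear_combination -this)
  · have hv : 2 * v j = c := hv
    ext i
    by_cases hij : i = j
    · subst hij
      simp [applyAff, monomialMatrix_mulVec, ← hv]
      ring
    · simp [applyAff, monomialMatrix_mulVec, hij]

/-- A criterion for the Steinberg property of `G(4,2,n) ⋉ Λ` with `Λ ⊆ ℤ[i]ⁿ`. -/
lemma steinbergProperty_of_lattice
    (hint : ∀ v ∈ Λ, ∀ j, v j ∈ gaussianSubring)
    (hswap : ∀ j l, ∀ ζ c : ℂ, ζ ^ 4 = 1 → c ∈ gaussianSubring →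
      Pi.single j c - Pi.single l (ζ⁻¹ * c) ∈ Λ)
    (heven : ∀ j, ∀ c ∈ evenGaussian, Pi.single j c ∈ Λ)
    (hodd : ∀ v ∈ Λ, ∀ j, Pi.single j (v j) ∈ Λ ∨ ∃ l, j ≠ l ∧ v l ∉ evenGaussian) :
    SteinbergProperty (fun g => IsGrpn 4 2 n g.1 ∧ g.2 ∈ Λ) := by
  rintro u ⟨⟨M, t⟩, ⟨⟨hrow, -, hpow, -⟩, ht⟩, ⟨v, hv⟩, hu⟩
  simp only at hrow hpow ht
  choose σ hσ hσu using hrow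
  have hmul : ∀ w i, (M *ᵥ w) i = M i (σ i) * w (σ i) := by
    intro w i
    refine Finset.sum_eq_single (σ i) (fun j _ hj => ?_) (fun h => absurd (Finset.mem_univ _) h)
    exact mul_eq_zero_of_left (not_imp_comm.1 (hσu i j) hj) (w j)
  have hu' : ∀ i, M i (σ i) * u (σ i) + t i = u i := by
    intro i
    rw [← hmul]
    exact congrFun hu i
  have swapCase : ∀ j l, ∀ ζ : ℂ, j ≠ l → ζ ^ 4 = 1 → u j - ζ * u l ∈ gaussianSubring →
      ∃ H, IsReflectingHyperplane (fun g => IsGrpn 4 2 n g.1 ∧ g.2 ∈ Λ) H ∧ u ∈ H :=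
    fun j l ζ hjl hζ hc => ⟨_, isReflectingHyperplane_swap hjl hζ (hswap j l ζ _ hζ hc), rfl⟩
  have negCase : ∀ j, Pi.single j (2 * u j) ∈ Λ →
      ∃ H, IsReflectingHyperplane (fun g => IsGrpn 4 2 n g.1 ∧ g.2 ∈ Λ) H ∧ u ∈ H :=
    fun j hc => ⟨_, isReflectingHyperplane_neg hc, rfl⟩
  by_cases hid : ∃ i, i ≠ σ i
  · obtain ⟨i, hi⟩ := hid
    refine swapCase i (σ i) (M i (σ i)) hi (hpow i _ (hσ i)) ?_
    convert hint t ht i using 1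
    linear_combination -hu' i
  push Not at hid
  simp only [← hid] at hσ hmul hu'
  have iCase : ∀ j, M j j = I ∨ M j j = -I →
      ∃ H, IsReflectingHyperplane (fun g => IsGrpn 4 2 n g.1 ∧ g.2 ∈ Λ) H ∧ u ∈ H := by
    rintro j (h | h) <;> refine negCase j (heven j _ ?_) <;> have huj := hu' j <;> rw [h] at huj
    · convert mul_mem_evenGaussian (hint t ht j) one_add_I_mem_evenGaussian using 1
      linear_combination -(1 + I) * huj + u j * I_mul_I
    · convert mul_mem_evenGaussian (hint t ht j) one_sub_I_mem_evenGaussian using 1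
      linear_combination -(1 - I) * huj + u j * I_mul_I
  have fixed : ∀ j, M j j = 1 → t j = 0 := fun j h => by
    have := hu' j
    rw [h] at this
    linear_combination this
  have twice : ∀ j, M j j = -1 → 2 * u j = t j := fun j h => by
    have := hu' j
    rw [h] at this
    linear_combination -this
  obtain ⟨i, hi⟩ : ∃ i, M i i ≠ 1 := by
    by_contra! h
    refine hv ?_
    ext i
    simp [applyAff, hmul, h, fixed]
  rcases eq_of_pow_four_eq_one (hpow i i (hσ i)) with h | h | h
  · exact absurd h hi
  · rcases hodd t ht i with hs | ⟨l, hil, hl⟩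
    · exact negCase i (twice i h ▸ hs)
    rcases eq_of_pow_four_eq_one (hpow l l (hσ l)) with h' | h' | h'
    · rw [fixed l h'] at hl
      exact absurd (zero_mem _) hl
    · by_cases hti : t i ∈ evenGaussian
      · exact negCase i (twice i h ▸ heven i _ hti)
      obtain ⟨ζ, hζ, w, hw, hw'⟩ :=
        exists_unit_sub_eq_two_mul (hint t ht i) (hint t ht l) hti hl
      refine swapCase i l ζ hil hζ ?_
      convert hw using 1
      linear_combination hw' / 2 + twice i h / 2 - ζ / 2 * twice l h'
    · exact iCase l h'
  · exact iCase i h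

end Monomial

section Lattice

variable {n : ℕ}

lemma genB_of_pos (ξ : ℂ) (j : ℕ) (hj : j + 1 < n) :
    genB n ξ ⟨j + 1, hj⟩ = Pi.single ⟨j, by omega⟩ 1 - Pi.single ⟨j + 1, hj⟩ 1 := by
  ext i
  simp only [genB, stdGen, Nat.add_eq_zero_iff, one_ne_zero, and_false, if_false,
    Nat.add_right_cancel_iff, Pi.sub_apply, Pi.single_apply, Fin.ext_iff]
  split_ifs <;> first | omega | simp

lemma genB_zero (hn : 2 ≤ n) (ξ : ℂ) :
    genB n ξ ⟨0, by omega⟩ = Pi.single ⟨0, by omega⟩ ξ - Pi.single ⟨1, by omega⟩ 1 := by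
  ext i
  simp only [genB, if_true, Pi.sub_apply, Pi.single_apply, Fin.ext_iff]
  split_ifs <;> first | omega | simp

/-- The `ℤ[i]`-span of the generators is the lattice of Gaussian integer vectors whose coordinate
sum is divisible by `1 + i`. -/
lemma mem_span_genB_iff (hn : 2 ≤ n) (v : Fin n → ℂ) :
    v ∈ Submodule.span gaussianSubring (Set.range (genB n I)) ↔
      (∀ j, v j ∈ gaussianSubring) ∧ ∑ j, v j ∈ evenGaussian := by
  constructor
  · intro hv
    induction hv using Submodule.span_induction with
    | mem x hx =>
      obtain ⟨⟨j, hj⟩, rfl⟩ := hx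
      rcases j with _ | j
      · rw [genB_zero hn]
        refine ⟨fun i => ?_, ?_⟩
        · simp only [Pi.sub_apply, Pi.single_apply]
          refine sub_mem ?_ ?_ <;> split_ifs <;>
            simp [I_mem_gaussianSubring, zero_mem, one_mem]
        · simp only [Pi.sub_apply, Finset.sum_sub_distrib, Finset.sum_pi_single', Finset.mem_univ,
            if_true]
          simpa using neg_mem one_sub_I_mem_evenGaussian
      · rw [genB_of_pos]
        refine ⟨fun i => ?_, ?_⟩
        · simp only [Pi.sub_apply, Pi.single_apply]
          refine sub_mem ?_ ?_ <;> split_ifs <;> simp [zero_mem, one_mem]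
        · simp [Finset.sum_sub_distrib, zero_mem]
    | zero => simp [zero_mem]
    | add x y _ _ hx hy =>
      exact ⟨fun j => add_mem (hx.1 j) (hy.1 j), by
        simpa [Finset.sum_add_distrib] using add_mem hx.2 hy.2⟩
    | smul a x _ hx =>
      refine ⟨fun j => mul_mem a.2 (hx.1 j), ?_⟩
      convert mul_mem_evenGaussian a.2 hx.2 using 1
      rw [Finset.mul_sum]
      rfl
  · rintro ⟨hv, hsum⟩
    set S := Submodule.span gaussianSubring (Set.range (genB n I))
    have hgen : ∀ j, genB n I j ∈ S := fun j => Submodule.subset_span ⟨j, rfl⟩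
    have hsmul : ∀ a ∈ gaussianSubring, ∀ w ∈ S, a • w ∈ S := fun a ha w hw =>
      S.smul_mem (⟨a, ha⟩ : gaussianSubring) hw
    let o : Fin n := ⟨0, by omega⟩
    have hdiff : ∀ (k : ℕ) (hk : k < n), Pi.single ⟨k, hk⟩ (1 : ℂ) - Pi.single o 1 ∈ S := by
      intro k
      induction k with
      | zero => intro hk; simp [o, zero_mem]
      | succ k ih =>
        intro hk
        have h := S.sub_mem (ih (by omega)) (hgen ⟨k + 1, hk⟩)
        rw [genB_of_pos] at h
        convert h using 1
        abel
    have ho : Pi.single o (1 - I) ∈ S := by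
      have h := S.neg_mem (S.add_mem (hgen o) (hdiff 1 (by omega)))
      rw [genB_zero hn] at h
      convert h using 1
      rw [Pi.single_sub]
      abel
    obtain ⟨w, hw, hw'⟩ := exists_eq_one_sub_I_mul hsum
    have key : v = ∑ j, v j • (Pi.single j (1 : ℂ) - Pi.single o 1) + w • Pi.single o (1 - I) := by
      have h₁ : w • (Pi.single o (1 - I) : Fin n → ℂ) = (∑ j, v j) • Pi.single o 1 := by
        rw [hw', ← Pi.single_smul, ← Pi.single_smul]
        simp [mul_comm]
      rw [h₁, Finset.sum_smul, ← Finset.sum_add_distrib]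
      simp only [← smul_add, sub_add_cancel]
      exact pi_eq_sum_univ' v
    rw [key]
    exact S.add_mem (S.sum_mem fun j _ => hsmul _ (hv j) _ (hdiff j j.2)) (hsmul _ hw _ ho)

lemma single_mem_gaussianSubring {c : ℂ} (hc : c ∈ gaussianSubring) (j i : Fin n) :
    (Pi.single j c : Fin n → ℂ) i ∈ gaussianSubring := by
  rw [Pi.single_apply]
  split_ifs
  exacts [hc, zero_mem _]

end Lattice

lemma evenGaussian_le {c : ℂ} (hc : c ∈ evenGaussian) : c ∈ gaussianSubring := by
  obtain ⟨a, b, -, rfl⟩ := hc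
  exact ⟨a, b, rfl⟩

lemma inv_mem_gaussianSubring {ζ : ℂ} (hζ : ζ ^ 4 = 1) : ζ⁻¹ ∈ gaussianSubring :=
  mem_gaussianSubring_of_pow_four (by rw [inv_pow, hζ, inv_one])

/-- Steinberg's theorem for `[G(4,2,n)]₁` and `[G(4,2,n)]₂`, with lattices
`Λ₁ = ℤ[i](ie₁ - e₂) + Σ_{j=2}^n ℤ[i](e_{j-1} - e_j)` and `Λ₂ = Λ₁ + ℤ[i]e_n`. -/
theorem steinberg_G_4_2_n_lattices (n : ℕ) (hn : 2 ≤ n)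
    (Λ₁ Λ₂ : Set (Fin n → ℂ))
    (hΛ₁ : Λ₁ = {v | ∃ c : Fin n → ℂ, (∀ j, c j ∈ Zlat Complex.I) ∧
      v = ∑ j, c j • genB n Complex.I j})
    (hΛ₂ : Λ₂ = {v | ∃ w ∈ Λ₁, ∃ d ∈ Zlat Complex.I,
      v = w + d • (Pi.single (⟨n - 1, by omega⟩ : Fin n) (1 : ℂ) : Fin n → ℂ)}) :
    SteinbergProperty (fun g => IsGrpn 4 2 n g.1 ∧ g.2 ∈ Λ₁) ∧
    SteinbergProperty (fun g => IsGrpn 4 2 n g.1 ∧ g.2 ∈ Λ₂) := by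
  have mem₁ : ∀ v, v ∈ Λ₁ ↔ (∀ j, v j ∈ gaussianSubring) ∧ ∑ j, v j ∈ evenGaussian := by
    intro v
    rw [← mem_span_genB_iff hn, Submodule.mem_span_range_iff_exists_fun, hΛ₁]
    constructor
    · rintro ⟨c, hc, rfl⟩
      exact ⟨fun j => ⟨c j, hc j⟩, rfl⟩
    · rintro ⟨c, rfl⟩
      exact ⟨fun j => c j, fun j => (c j).2, rfl⟩
  have mem₂ : ∀ v, v ∈ Λ₂ ↔ ∀ j, v j ∈ gaussianSubring := by
    intro v
    rw [hΛ₂]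
    constructor
    · rintro ⟨w, hw, d, hd, rfl⟩ j
      exact add_mem (((mem₁ w).1 hw).1 j)
        (mul_mem hd (single_mem_gaussianSubring (one_mem _) _ j))
    · intro hv
      have hd : ∑ j, v j ∈ gaussianSubring := sum_mem fun j _ => hv j
      refine ⟨v - (∑ j, v j) • Pi.single ⟨n - 1, by omega⟩ 1, (mem₁ _).2 ⟨fun j => ?_, ?_⟩,
        _, hd, by simp⟩
      · exact sub_mem (hv j) (mul_mem hd (single_mem_gaussianSubring (one_mem _) _ j))
      · simp [Finset.sum_sub_distrib, ← Finset.mul_sum, zero_mem]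
  have swap_int : ∀ (j l : Fin n) (ζ c : ℂ), ζ ^ 4 = 1 → c ∈ gaussianSubring → ∀ i,
      (Pi.single j c - Pi.single l (ζ⁻¹ * c) : Fin n → ℂ) i ∈ gaussianSubring :=
    fun j l ζ c hζ hc i => sub_mem (single_mem_gaussianSubring hc j i)
      (single_mem_gaussianSubring (mul_mem (inv_mem_gaussianSubring hζ) hc) l i)
  constructor
  · refine steinbergProperty_of_lattice (fun v hv => ((mem₁ v).1 hv).1)
      (fun j l ζ c hζ hc => (mem₁ _).2 ⟨swap_int j l ζ c hζ hc, ?_⟩)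
      (fun j c hc => (mem₁ _).2
        ⟨single_mem_gaussianSubring (evenGaussian_le hc) j, by simpa using hc⟩)
      (fun v hv j => ?_)
    · have h : (ζ⁻¹) ^ 4 = 1 := by rw [inv_pow, hζ, inv_one]
      convert mul_mem_evenGaussian hc (one_sub_mem_evenGaussian h) using 1
      simp [Finset.sum_sub_distrib]
      ring
    · obtain ⟨hint, hsum⟩ := (mem₁ v).1 hv
      by_contra! h
      refine h.1 ((mem₁ _).2 ⟨single_mem_gaussianSubring (hint j) j, ?_⟩)
      rw [← Finset.add_sum_erase _ _ (Finset.mem_univ j)] at hsum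
      have hrest : ∑ l ∈ Finset.univ.erase j, v l ∈ evenGaussian :=
        sum_mem fun l hl => h.2 l (Finset.ne_of_mem_erase hl).symm
      simpa using sub_mem hsum hrest
  · exact steinbergProperty_of_lattice (fun v hv => (mem₂ v).1 hv)
      (fun j l ζ c hζ hc => (mem₂ _).2 (swap_int j l ζ c hζ hc))
      (fun j c hc => (mem₂ _).2 (single_mem_gaussianSubring (evenGaussian_le hc) j))
      (fun v hv j => Or.inl ((mem₂ _).2 (single_mem_gaussianSubring ((mem₂ v).1 hv j) j)))
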